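/- For every even m ≥ 2, every palindrome in V(D*_m) — every binary word p ∈ V(D*_m) with p i = p (m−1−i) for all i — is mutually reachable with the all-false word 0^m in the transfer digraph D*_m (i.e., all palindromic vertices lie in the component R*_m = A*_m of D*_m containing 0^m). -/

import Mathlib

/-- The six alpha-letters, recording which two of the four directions are used
at a grid vertex by a 2-factor: `a` = down&right, `b` = up&down, `c` = up&right,
`d` = down&left, `e` = left&right, `f` = up&left. -/
inductive Alpha : Type
  | a | b | c | d | e | f
  deriving DecidableEq

/-- The letter has a right edge iff it lies in `{a, c, e}`. -/
def Alpha.right : Alpha → Bool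
  | .a => true
  | .c => true
  | .e => true
  | _ => false

/-- The letter has a left edge iff it lies in `{d, e, f}`. -/
def Alpha.left : Alpha → Bool
  | .d => true
  | .e => true
  | .f => true
  | _ => false

/-- The letter has a down edge iff it lies in `{a, b, d}`. -/
def Alpha.down : Alpha → Bool
  | .a => true
  | .b => true
  | .d => true
  | _ => false

/-- The letter has an up edge iff it lies in `{b, c, f}`. -/
def Alpha.up : Alpha → Bool
  | .b => true
  | .c => true
  | .f => true
  | _ => false

/-- Membership in the vertex set `V(D_m)` of the digraph `D_m`: consecutive letters are
compatible (`w i` has a down edge iff `w (i+1)` has an up edge), the first letter has no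
up edge, and the last letter has no down edge. -/
def InVD {m : ℕ} (w : Fin m → Alpha) : Prop :=
  (∀ i j : Fin m, (j : ℕ) = (i : ℕ) + 1 → (w i).down = (w j).up) ∧
  (∀ i : Fin m, (i : ℕ) = 0 → (w i).up = false) ∧
  (∀ i : Fin m, (i : ℕ) = m - 1 → (w i).down = false)

/-- The arc relation of the digraph `D_m`: `v → u` iff both are vertices of `D_m` and for
every `i`, `v i` has a right edge iff `u i` has a left edge. -/
def DArc {m : ℕ} (v u : Fin m → Alpha) : Prop :=
  InVD v ∧ InVD u ∧ ∀ i, (v i).right = (u i).left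

/-- The outlet word of an alpha-word: `o(w) i = true` iff `w i` has a right edge. -/
def outlet {m : ℕ} (w : Fin m → Alpha) : Fin m → Bool :=
  fun i => (w i).right

/-- Membership in the vertex set `V(D*_m)` of the transfer digraph `D*_m`: the binary
words realized as outlet words of vertices of `D_m`. -/
def InVDStar {m : ℕ} (p : Fin m → Bool) : Prop :=
  ∃ w : Fin m → Alpha, InVD w ∧ outlet w = p

/-- The arc relation of the transfer digraph `D*_m`: `p → q` iff there are vertices
`v, u` of `D_m` with outlet words `p, q` and an arc `v → u` in `D_m`. -/
def DStarArc {m : ℕ} (p q : Fin m → Bool) : Prop :=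
  ∃ v u : Fin m → Alpha, outlet v = p ∧ outlet u = q ∧ DArc v u

/-- The alpha-letter with prescribed left, right, up and down edges; meaningful when exactly two
of them are present. -/
def Alpha.ofEdges : Bool → Bool → Bool → Bool → Alpha
  | false, true, false, true => .a
  | false, false, true, true => .b
  | false, true, true, false => .c
  | true, false, false, true => .d
  | true, true, false, false => .e
  | _, _, _, _ => .f

theorem Alpha.ofEdges_spec (l r u d : Bool)
    (h : l.toNat + r.toNat + u.toNat + d.toNat = 2) :
    (ofEdges l r u d).left = l ∧ (ofEdges l r u d).right = r ∧
      (ofEdges l r u d).up = u ∧ (ofEdges l r u d).down = d := by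
  revert l r u d
  decide

/-- `p` and `q` are the left and right words of a column of a 2-factor, where `x i` tells whether
the vertical edge above row `i` is used. -/
def IsColumn {m : ℕ} (p q : Fin m → Bool) : Prop :=
  ∃ x : ℕ → Bool, x 0 = false ∧ x m = false ∧
    ∀ i : Fin m, (p i).toNat + (q i).toNat + (x i).toNat + (x (i + 1)).toNat = 2

theorem IsColumn.symm {m : ℕ} {p q : Fin m → Bool} (h : IsColumn p q) : IsColumn q p := by
  obtain ⟨x, h0, hm, h⟩ := h
  exact ⟨x, h0, hm, fun i => by have := h i; omega⟩

theorem IsColumn.exists_word {m : ℕ} {p q : Fin m → Bool} (h : IsColumn p q) :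
    ∃ w : Fin m → Alpha, InVD w ∧ (∀ i, (w i).left = p i) ∧ outlet w = q := by
  obtain ⟨x, h0, hm, h⟩ := h
  have spec := fun i => Alpha.ofEdges_spec _ _ _ _ (h i)
  refine ⟨fun i => Alpha.ofEdges (p i) (q i) (x i) (x (i + 1)), ⟨?_, ?_, ?_⟩,
    fun i => (spec i).1, funext fun i => (spec i).2.1⟩
  · intro i j hij
    rw [(spec i).2.2.2, (spec j).2.2.1, hij]
  · intro i hi
    rw [(spec i).2.2.1, hi, h0]
  · intro i hi
    rw [(spec i).2.2.2, show (i : ℕ) + 1 = m by have := i.isLt; omega, hm]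

theorem IsColumn.dStarArc {m : ℕ} {p q : Fin m → Bool} (h : IsColumn p q) : DStarArc p q := by
  obtain ⟨u, hu, hul, huo⟩ := h.exists_word
  obtain ⟨v, hv, -, hvo⟩ := h.symm.exists_word
  exact ⟨v, u, hvo, huo, hv, hu, fun i => by rw [hul i, ← hvo, outlet]⟩

/-- Two words are linked when they are joined by a sequence of columns. -/
abbrev Linked {m : ℕ} : (Fin m → Bool) → (Fin m → Bool) → Prop :=
  Relation.ReflTransGen IsColumn

theorem Linked.symm {m : ℕ} {p q : Fin m → Bool} (h : Linked p q) : Linked q p :=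
  haveI : Std.Symm (@IsColumn m) := ⟨fun _ _ => IsColumn.symm⟩
  Relation.ReflTransGen.stdSymm.symm _ _ h

theorem Linked.reachable {m : ℕ} {p q : Fin m → Bool} (h : Linked p q) :
    Relation.ReflTransGen DStarArc p q :=
  Relation.ReflTransGen.mono (fun _ _ => IsColumn.dStarArc) _ _ h

/-- The word `p` with the letters at `i` and `j` negated. -/
def togglePair {m : ℕ} (p : Fin m → Bool) (i j : Fin m) : Fin m → Bool :=
  fun k => if k = i ∨ k = j then !p k else p k

theorem togglePair_togglePair {m : ℕ} (p : Fin m → Bool) (i j : Fin m) :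
    togglePair (togglePair p i j) i j = p := by
  funext k
  simp only [togglePair]
  split <;> simp

theorem togglePair_comm {m : ℕ} (p : Fin m → Bool) (i j k l : Fin m) :
    togglePair (togglePair p i j) k l = togglePair (togglePair p k l) i j := by
  funext n
  simp only [togglePair]
  split <;> split <;> rfl

theorem isColumn_compl {m : ℕ} (hm : Even m) (p : Fin m → Bool) :
    IsColumn p (fun i => !p i) := by
  refine ⟨fun k => decide (k % 2 = 1), by simp, by simp [Nat.even_iff.mp hm], fun i => ?_⟩
  rcases Nat.mod_two_eq_zero_or_one i with h | h <;> cases hp : p i <;>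
    simp [h, hp, Nat.add_mod]

theorem isColumn_compl_togglePair {m : ℕ} (hm : Even m) (p : Fin m → Bool) (i j : Fin m)
    (hij : (j : ℕ) = i + 1) (hi : p i = decide ((i : ℕ) % 2 = 0)) (hj : p j = p i) :
    IsColumn p (fun k => !togglePair p i j k) := by
  have hm := Nat.even_iff.mp hm
  refine ⟨fun k => decide (k % 2 = 1) ^^ decide (k = (j : ℕ)), ?_, ?_, fun k => ?_⟩
  · simp [hij]
  · have := j.isLt
    simp [hm, this.ne']
  · by_cases hki : k = i
    · subst hki
      rcases Nat.mod_two_eq_zero_or_one k with h | h <;>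
        simp [togglePair, hi, hij, h, Nat.add_mod]
    · by_cases hkj : k = j
      · subst hkj
        rcases Nat.mod_two_eq_zero_or_one i with h | h <;>
          simp [togglePair, hj, hi, hij, h, Nat.add_mod]
      · have h1 : (k : ℕ) ≠ j := fun h => hkj (Fin.ext h)
        have h2 : (k : ℕ) + 1 ≠ j := fun h => hki (Fin.ext (by omega))
        rcases Nat.mod_two_eq_zero_or_one k with h | h <;> cases hp : p k <;>
          simp [togglePair, hki, hkj, h1, h2, h, hp, Nat.add_mod]

theorem linked_togglePair_adjacent {m : ℕ} (hm : Even m) (p : Fin m → Bool) (i j : Fin m)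
    (hij : (j : ℕ) = i + 1) (hj : p j = p i) : Linked p (togglePair p i j) := by
  have main : ∀ q : Fin m → Bool, q j = q i → q i = decide ((i : ℕ) % 2 = 0) →
      Linked q (togglePair q i j) := fun q hqj hqi =>
    .tail (.single (isColumn_compl_togglePair hm q i j hij hqi hqj))
      (isColumn_compl hm (togglePair q i j)).symm
  by_cases hi : p i = decide ((i : ℕ) % 2 = 0)
  · exact main p hj hi
  · have := main (togglePair p i j) (by simp [togglePair, hj])
      (by simpa [togglePair, Bool.eq_not] using hi)
    rw [togglePair_togglePair] at this
    exact this.symm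

theorem togglePair_rev_palindrome {m : ℕ} {p : Fin m → Bool} (hp : ∀ k, p k = p k.rev)
    (i k : Fin m) : togglePair p i i.rev k = togglePair p i i.rev k.rev := by
  simp only [togglePair, ← hp k, Fin.rev_eq_iff, Fin.rev_rev, or_comm]

theorem linked_togglePair_rev_of_lt {m : ℕ} (hm : Even m) (d : ℕ) :
    ∀ (p : Fin m → Bool), (∀ k, p k = p k.rev) → ∀ i : Fin m, 2 * (i + d + 1) = m →
      Linked p (togglePair p i i.rev) := by
  induction d with
  | zero =>
    intro p hp i hi
    exact linked_togglePair_adjacent hm p i i.rev (by rw [Fin.val_rev]; omega) (hp i).symm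
  | succ d ih =>
    intro p hp i hi
    obtain ⟨j, hj⟩ : ∃ j : Fin m, (j : ℕ) = i + 1 := ⟨⟨i + 1, by omega⟩, rfl⟩
    have hri := Fin.val_rev i
    have hrj := Fin.val_rev j
    have hne : i ≠ j ∧ i ≠ i.rev ∧ i ≠ j.rev ∧ j ≠ i.rev ∧ j ≠ j.rev ∧ i.rev ≠ j.rev := by
      simp only [ne_eq, Fin.ext_iff]
      omega
    obtain ⟨h1, h2, h3, h4, h5, h6⟩ := hne
    have both : ∀ q : Fin m → Bool, (∀ k, q k = q k.rev) → q j = q i →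
        Linked q (togglePair (togglePair q i i.rev) j j.rev) := by
      intro q hq hqj
      have a := linked_togglePair_adjacent hm q i j hj hqj
      have b := linked_togglePair_adjacent hm (togglePair q i j) j.rev i.rev (by omega)
        (by simp [togglePair, h3.symm, h2.symm, h4.symm, h5.symm, ← hq, hqj])
      convert a.trans b using 1
      funext k
      simp only [togglePair]
      grind
    by_cases hpj : p j = p i
    · have b := ih _ (togglePair_rev_palindrome (togglePair_rev_palindrome hp i) j) j (by omega)
      rw [togglePair_togglePair] at b
      exact (both p hp hpj).trans b
    · have a := ih p hp j (by omega)
      have b := both _ (togglePair_rev_palindrome hp j)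
        (by simpa [togglePair, h1, h3, Bool.not_eq, Bool.eq_not] using hpj)
      rw [togglePair_comm, togglePair_togglePair] at b
      exact a.trans b

theorem linked_togglePair_rev {m : ℕ} (hm : Even m) (p : Fin m → Bool)
    (hp : ∀ k, p k = p k.rev) (i : Fin m) : Linked p (togglePair p i i.rev) := by
  obtain ⟨n, hn⟩ := hm.two_dvd
  rcases lt_or_ge (i : ℕ) n with h | h
  · exact linked_togglePair_rev_of_lt hm (n - 1 - i) p hp i (by omega)
  · have hr := Fin.val_rev i
    have := linked_togglePair_rev_of_lt hm (n - 1 - i.rev) p hp i.rev (by omega)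
    convert this using 1
    funext k
    simp only [togglePair, Fin.rev_rev, or_comm]

theorem linked_allFalse_of_palindrome {m : ℕ} (hm : Even m) (s : Finset (Fin m)) :
    ∀ p : Fin m → Bool, (∀ k, p k = p k.rev) → (∀ k, p k = true → k ∈ s) →
      Linked p (fun _ => false) := by
  induction s using Finset.strongInduction with
  | H s ih =>
    intro p hp hs
    by_cases h : ∃ i, p i = true
    · obtain ⟨i, hi⟩ := h
      refine (linked_togglePair_rev hm p hp i).trans (ih (s.erase i)
        (Finset.erase_ssubset (hs i hi)) _ (togglePair_rev_palindrome hp i) fun k hk => ?_)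
      have := hp i
      simp only [togglePair] at hk
      grind
    · rw [show p = fun _ => false from funext fun i => by simpa using fun hi => h ⟨i, hi⟩]

/-- For even `m ≥ 2`, every palindromic vertex of `D*_m` is mutually reachable with the
all-false word `0^m` in the transfer digraph `D*_m`. -/
theorem palindrome_reaches_allFalse (m : ℕ) (hm : 2 ≤ m) (hme : Even m)
    (p : Fin m → Bool) (hp : InVDStar p) (hpal : ∀ i : Fin m, p i = p i.rev) :
    Relation.ReflTransGen DStarArc p (fun _ : Fin m => false) ∧
    Relation.ReflTransGen DStarArc (fun _ : Fin m => false) p := by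
  have h := linked_allFalse_of_palindrome hme Finset.univ p hpal fun k _ => Finset.mem_univ k
  exact ⟨h.reachable, h.symm.reachable⟩
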